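/- Consider the input A for the team power game with 3 teams and 2 time slots given by the matrix A = [[2,0],[2,2],[0,2]] (team 1 has true availabilities (2,0), team 2 has (2,2), team 3 has (0,2)). Then A admits no 2-strong Nash equilibrium: for every strategy profile B for A there is a nonempty coalition of at most two teams that has an improvement step with respect to B. -/

import Mathlib

open Finset

section TPG

variable {T C : Type*} [Fintype T] [Fintype C] [DecidableEq T] [DecidableEq C]

/-- Sum of declared availabilities at a time slot. -/
def colSum (B : T → C → ℕ) (j : C) : ℕ := ∑ i, B i j

/-- Winning time slots: those maximizing the column sum. -/
def winners (B : T → C → ℕ) : Finset C :=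
  Finset.univ.filter fun j => ∀ j', colSum B j' ≤ colSum B j

/-- Relative power of team `i` at slot `j` (0 when the denominator is 0). -/
def power (B : T → C → ℕ) (i : T) (j : C) : ℚ :=
  (B i j : ℚ) / (colSum B j : ℚ)

/-- Pay-off of team `i`: minimum relative power over all winning slots. -/
def payoff (B : T → C → ℕ) (i : T) : ℚ :=
  if h : (winners B).Nonempty then (winners B).inf' h (power B i) else 0

/-- `B` is a strategy profile for input `A`. -/
def IsProfile (A B : T → C → ℕ) : Prop := ∀ i j, B i j ≤ A i j

/-- `D` is an improvement step for coalition `S` with respect to `B` (for input `A`). -/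
def IsImprovement (A B : T → C → ℕ) (S : Finset T) (D : T → C → ℕ) : Prop :=
  IsProfile A D ∧ (∀ i ∉ S, ∀ j, D i j = B i j) ∧ ∀ i ∈ S, payoff B i < payoff D i

/-- `B` is a `t`-strong Nash equilibrium for `A`. -/
def IsStrongNash (t : ℕ) (A B : T → C → ℕ) : Prop :=
  IsProfile A B ∧
    ∀ S : Finset T, S.Nonempty → S.card ≤ t → ∀ D, ¬ IsImprovement A B S D

end TPG

theorem colSum_reindex {T C : Type*} [Fintype T] (e : T ≃ T) (f : C ≃ C) (B : T → C → ℕ) (j : C) :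
    colSum (fun i j => B (e i) (f j)) j = colSum B (f j) :=
  e.sum_comp fun i => B i (f j)

section TPG

variable {T C : Type*} [Fintype T] [Fintype C]

theorem mem_winners {B : T → C → ℕ} {j : C} :
    j ∈ winners B ↔ ∀ j', colSum B j' ≤ colSum B j := by
  simp [winners]

theorem winners_nonempty [Nonempty C] (B : T → C → ℕ) : (winners B).Nonempty := by
  obtain ⟨j, hj⟩ := Finite.exists_max (colSum B)
  exact ⟨j, mem_winners.2 hj⟩

theorem le_payoff_iff [Nonempty C] {B : T → C → ℕ} {i : T} {x : ℚ} :
    x ≤ payoff B i ↔ ∀ j ∈ winners B, x ≤ power B i j := by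
  rw [payoff, dif_pos (winners_nonempty B), Finset.le_inf'_iff]

theorem payoff_le_power {B : T → C → ℕ} {j : C} (hj : j ∈ winners B) (i : T) :
    payoff B i ≤ power B i j :=
  have : Nonempty C := ⟨j⟩
  le_payoff_iff.1 le_rfl j hj

theorem power_le_payoff {B : T → C → ℕ} {j : C}
    (hj : ∀ j', j' ≠ j → colSum B j' < colSum B j) (i : T) : power B i j ≤ payoff B i := by
  have : Nonempty C := ⟨j⟩
  refine le_payoff_iff.2 fun k hk => ?_
  by_cases h : k = j
  · rw [h]
  · exact absurd (mem_winners.1 hk j) (hj k h).not_ge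

theorem mem_winners_reindex (e : T ≃ T) (f : C ≃ C) (B : T → C → ℕ) (j : C) :
    j ∈ winners (fun i j => B (e i) (f j)) ↔ f j ∈ winners B := by
  simp only [mem_winners, colSum_reindex]
  exact f.forall_congr_left.trans (by simp)

theorem payoff_reindex [Nonempty C] (e : T ≃ T) (f : C ≃ C) (B : T → C → ℕ) (i : T) :
    payoff (fun i j => B (e i) (f j)) i = payoff B (e i) := by
  refine eq_of_forall_le_iff fun x => ?_
  simp only [le_payoff_iff, mem_winners_reindex, power, colSum_reindex]
  exact f.forall_congr_left.trans (by simp)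

theorem IsImprovement.reindex [Nonempty C] {A B D : T → C → ℕ} {S : Finset T}
    (e : T ≃ T) (f : C ≃ C) (h : IsImprovement A B S D) :
    IsImprovement (fun i j => A (e i) (f j)) (fun i j => B (e i) (f j))
      (S.map e.symm.toEmbedding) (fun i j => D (e i) (f j)) := by
  refine ⟨fun i j => h.1 _ _, fun i hi j => h.2.1 _ (by simpa using hi) _, fun i hi => ?_⟩
  rw [payoff_reindex, payoff_reindex]
  exact h.2.2 _ (by simpa using hi)

end TPG

/-- If the first slot wins, either the last two teams gain by meeting in the second slot, or the
first team gains by declaring its full availability. -/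
theorem exists_improvement_of_zero_mem_winners {B : Fin 3 → Fin 2 → ℕ}
    (hB : IsProfile (![![2, 0], ![2, 2], ![0, 2]] : Fin 3 → Fin 2 → ℕ) B)
    (h0 : 0 ∈ winners B) :
    ∃ (S : Finset (Fin 3)) (D : Fin 3 → Fin 2 → ℕ),
      S.Nonempty ∧ S.card ≤ 2 ∧
      IsImprovement (![![2, 0], ![2, 2], ![0, 2]] : Fin 3 → Fin 2 → ℕ) B S D := by
  have h00 : B 0 0 ≤ 2 := hB 0 0
  have h01 : B 0 1 = 0 := Nat.le_zero.1 (hB 0 1)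
  have h10 : B 1 0 ≤ 2 := hB 1 0
  have h11 : B 1 1 ≤ 2 := hB 1 1
  have h20 : B 2 0 = 0 := Nat.le_zero.1 (hB 2 0)
  have h21 : B 2 1 ≤ 2 := hB 2 1
  have hle : B 1 1 + B 2 1 ≤ B 0 0 + B 1 0 := by
    simpa [colSum, Fin.sum_univ_three, h01, h20] using mem_winners.1 h0 1
  have hpay := payoff_le_power h0
  simp only [power, colSum, Fin.sum_univ_three, h20] at hpay
  by_cases hcase : B 0 0 = 2 ∨ B 1 0 = 0
  · let D : Fin 3 → Fin 2 → ℕ := ![![B 0 0, 0], ![0, 2], ![0, 1]]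
    have hD : ∀ j, j ≠ 1 → colSum D j < colSum D 1 := by
      intro j hj
      fin_cases j
      · simp [D, colSum, Fin.sum_univ_three]; omega
      · simp at hj
    refine ⟨{1, 2}, D, by simp, by simp, ?_, ?_, ?_⟩
    · intro i j
      fin_cases i <;> fin_cases j <;> simp [D, h00]
    · intro i hi j
      fin_cases i <;> fin_cases j <;> simp_all [D]
    · intro i hi
      refine lt_of_lt_of_le ((hpay i).trans_lt ?_) (power_le_payoff hD i)
      have hsum : colSum D 1 = 3 := by simp [D, colSum, Fin.sum_univ_three]
      obtain rfl | rfl : i = 1 ∨ i = 2 := by simpa using hi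
      · have h1 : D 1 1 = 2 := rfl
        rw [power, hsum, h1]
        rcases hcase with h | h
        · interval_cases B 1 0 <;> norm_num [h]
        · norm_num [h]
      · have h1 : D 2 1 = 1 := rfl
        rw [power, hsum, h1, h20]
        norm_num
  · push Not at hcase
    let D : Fin 3 → Fin 2 → ℕ := ![![2, 0], B 1, B 2]
    have hD : ∀ j, j ≠ 0 → colSum D j < colSum D 0 := by
      intro j hj
      fin_cases j
      · simp at hj
      · simp [D, colSum, Fin.sum_univ_three, h20]; omega
    refine ⟨{0}, D, by simp, by simp, ?_, ?_, ?_⟩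
    · intro i j
      fin_cases i <;> fin_cases j <;> simp [D, h10, h11, h20, h21]
    · intro i hi j
      fin_cases i <;> simp_all [D]
    · intro i hi
      obtain rfl : i = 0 := by simpa using hi
      refine lt_of_lt_of_le ((hpay 0).trans_lt ?_) (power_le_payoff hD 0)
      have hp : (0 : ℚ) < B 1 0 := by exact_mod_cast Nat.pos_of_ne_zero hcase.2
      have ha : (B 0 0 : ℚ) < 2 := by exact_mod_cast lt_of_le_of_ne h00 hcase.1
      have hsum : colSum D 0 = 2 + B 1 0 := by simp [D, colSum, Fin.sum_univ_three, h20]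
      have h1 : D 0 0 = 2 := rfl
      rw [power, hsum, h1]
      push_cast
      rw [div_lt_div_iff₀ (by positivity) (by positivity)]
      nlinarith

/-- The input `A = [[2,0],[2,2],[0,2]]` admits no 2-strong Nash equilibrium:
for every strategy profile `B` for `A`, some nonempty coalition of at most two teams
has an improvement step with respect to `B`. -/
theorem no_two_strong_nash_example :
    ∀ B : Fin 3 → Fin 2 → ℕ,
      IsProfile (![![2, 0], ![2, 2], ![0, 2]] : Fin 3 → Fin 2 → ℕ) B →
      ∃ (S : Finset (Fin 3)) (D : Fin 3 → Fin 2 → ℕ),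
        S.Nonempty ∧ S.card ≤ 2 ∧
        IsImprovement (![![2, 0], ![2, 2], ![0, 2]] : Fin 3 → Fin 2 → ℕ) B S D := by
  intro B hB
  have hA : (fun i j => (![![2, 0], ![2, 2], ![0, 2]] : Fin 3 → Fin 2 → ℕ)
      (Fin.revPerm i) (Fin.revPerm j)) = ![![2, 0], ![2, 2], ![0, 2]] := by
    decide
  obtain ⟨j, hj⟩ := winners_nonempty B
  obtain rfl | rfl : j = 0 ∨ j = 1 := by omega
  · exact exists_improvement_of_zero_mem_winners hB hj
  · obtain ⟨S, D, hS, hcard, hD⟩ := exists_improvement_of_zero_mem_winners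
      (B := fun i j => B (Fin.revPerm i) (Fin.revPerm j))
      (by rw [← hA]; exact fun i j => hB _ _) ((mem_winners_reindex _ _ B 0).2 hj)
    have h := hD.reindex Fin.revPerm Fin.revPerm
    simp only [hA] at h
    exact ⟨_, _, hS.map, (Finset.card_map _).trans_le hcard, by simpa using h⟩
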